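/- Let N be an infinite set of positive integers. Then the group A_5 ⟅^N ℤ is not virtually solvable: it has no solvable subgroup of finite index. -/

import Mathlib

/-- The alternating group on five letters. -/
abbrev A5 : Type := alternatingGroup (Fin 5)

/-- The disjoint union `⨆_{n ∈ N} G^n`. -/
abbrev SN (G : Type*) (N : Set ℕ) : Type _ := Σ n : N, Fin (n : ℕ) → G

/-- The permutation of `⨆_{n ∈ N} G^n` multiplying the first coordinate on the left by `a`. -/
def rho {G : Type*} [Group G] {N : Set ℕ} (a : G) : Equiv.Perm (SN G N) :=
  Equiv.sigmaCongrRight fun _n =>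
    Equiv.piCongrRight fun i => if (i : ℕ) = 0 then Equiv.mulLeft a else Equiv.refl G

/-- The permutation of `⨆_{n ∈ N} G^n` rotating each tuple:
`(g_1, …, g_n) ↦ (g_2, …, g_n, g_1)`. -/
def rot (G : Type*) (N : Set ℕ) : Equiv.Perm (SN G N) :=
  Equiv.sigmaCongrRight fun n => (Equiv.arrowCongr (finRotate (n : ℕ)) (Equiv.refl G)).symm

/-- The group `G ⟅^N ℤ`: the subgroup of permutations of `⨆_{n ∈ N} G^n` generated by the
rotation `↻` together with the `ρ_a`, `a ∈ G`. -/
def WreathZ (G : Type*) [Group G] (N : Set ℕ) : Subgroup (Equiv.Perm (SN G N)) :=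
  Subgroup.closure (insert (rot G N) (Set.range (rho (G := G) (N := N))))

theorem rot_mem {G : Type*} [Group G] {N : Set ℕ} : rot G N ∈ WreathZ G N :=
  Subgroup.subset_closure (Set.mem_insert _ _)

theorem rho_mem {G : Type*} [Group G] {N : Set ℕ} (a : G) :
    rho (G := G) (N := N) a ∈ WreathZ G N :=
  Subgroup.subset_closure (Set.mem_insert_of_mem _ ⟨a, rfl⟩)

theorem perm_inv_self {α : Type*} (e : Equiv.Perm α) (x : α) : e⁻¹ (e x) = x :=
  e.symm_apply_apply x

theorem finRotate_pow_zero (n : ℕ) (i : ℕ) (hi : i < n) (h0 : 0 < n) :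
    (finRotate n ^ i) ⟨0, h0⟩ = ⟨i, hi⟩ := by
  induction i with
  | zero => rfl
  | succ i ih =>
    rw [pow_succ', Equiv.Perm.mul_apply, ih (by omega)]
    obtain ⟨m, rfl⟩ : ∃ m, n = m + 1 := ⟨n - 1, by omega⟩
    exact finRotate_of_lt (by omega)

/-- The conjugate of `rho a` by a power of the rotation. -/
def hconj {N : Set ℕ} (i : ℕ) (a : A5) : WreathZ A5 N :=
  ⟨rot A5 N, rot_mem⟩ ^ (-(i : ℤ)) * ⟨rho a, rho_mem a⟩ * ⟨rot A5 N, rot_mem⟩ ^ (i : ℤ)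

theorem rot_pow_apply {N : Set ℕ} (n : N) (i : ℕ) (g : Fin (n : ℕ) → A5) :
    (rot A5 N ^ i) ⟨n, g⟩ = ⟨n, fun k => g ((finRotate (n : ℕ) ^ i) k)⟩ := by
  induction i with
  | zero => rfl
  | succ i ih =>
    rw [pow_succ', Equiv.Perm.mul_apply, ih]
    simp only [pow_succ]
    rfl

theorem hconj_apply {N : Set ℕ} (n : N) (i : ℕ) (a : A5) (g : Fin (n : ℕ) → A5) :
    (hconj i a : WreathZ A5 N).1 ⟨n, g⟩ =
      ⟨n, fun k => if ((((finRotate (n : ℕ)) ^ i)⁻¹ k : Fin n) : ℕ) = 0 then a * g k else g k⟩ := by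
  have : (hconj i a : WreathZ A5 N).1 = (rot A5 N ^ i)⁻¹ * rho a * rot A5 N ^ i := by
    simp [hconj]
  rw [this, Equiv.Perm.mul_apply, Equiv.Perm.mul_apply, Equiv.Perm.inv_eq_iff_eq,
    rot_pow_apply, rot_pow_apply]
  simp only [rho, Equiv.sigmaCongrRight_apply]
  congr 1
  funext k
  simp only [Equiv.piCongrRight_apply, Pi.map_apply, perm_inv_self]
  split_ifs <;> rfl

theorem hconj_inv {N : Set ℕ} (i : ℕ) (a : A5) :
    (hconj i a : WreathZ A5 N)⁻¹ = hconj i a⁻¹ := by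
  rw [inv_eq_iff_mul_eq_one]
  apply Subtype.ext
  apply Equiv.ext
  rintro ⟨n, g⟩
  rw [Subgroup.coe_mul, Equiv.Perm.mul_apply, hconj_apply, hconj_apply]
  simp only [OneMemClass.coe_one, Equiv.Perm.one_apply]
  congr 1
  funext k
  split_ifs <;> simp

/-- `x` preserves the component `n` and multiplies coordinate `c` by `a`. -/
def Acts {N : Set ℕ} (n : N) (c : Fin (n : ℕ)) (x : WreathZ A5 N) (a : A5) : Prop :=
  ∀ g, ∃ g', x.1 ⟨n, g⟩ = ⟨n, g'⟩ ∧ g' c = a * g c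

theorem Acts.mul {N : Set ℕ} {n : N} {c : Fin (n : ℕ)} {x y : WreathZ A5 N} {a b : A5}
    (hx : Acts n c x a) (hy : Acts n c y b) : Acts n c (x * y) (a * b) := by
  intro g
  obtain ⟨g', h1, h2⟩ := hy g
  obtain ⟨g'', h3, h4⟩ := hx g'
  refine ⟨g'', ?_, ?_⟩
  · rw [Subgroup.coe_mul, Equiv.Perm.mul_apply, h1, h3]
  · rw [h4, h2, mul_assoc]

theorem Acts.one {N : Set ℕ} {n : N} {c : Fin (n : ℕ)} : Acts n c (1 : WreathZ A5 N) 1 :=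
  fun g => ⟨g, rfl, (one_mul _).symm⟩

theorem acts_self {N : Set ℕ} (n : N) (i : ℕ) (hi : i < n) (a : A5) :
    Acts n ⟨i, hi⟩ (hconj i a) a := by
  intro g
  refine ⟨_, hconj_apply n i a g, ?_⟩
  have h0 : 0 < (n : ℕ) := by omega
  rw [← finRotate_pow_zero n i hi h0, perm_inv_self]
  simp

theorem acts_ne {N : Set ℕ} (n : N) (i j : ℕ) (hi : i < n) (hj : j < n) (hij : i ≠ j) (a : A5) :
    Acts n ⟨i, hi⟩ (hconj j a) 1 := by
  intro g
  refine ⟨_, hconj_apply n j a g, ?_⟩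
  have h0 : 0 < (n : ℕ) := by omega
  rw [if_neg, one_mul]
  intro h
  have h' : ((finRotate (n : ℕ)) ^ j)⁻¹ ⟨i, hi⟩ = ⟨0, h0⟩ := Fin.ext h
  rw [Equiv.Perm.inv_eq_iff_eq, finRotate_pow_zero n j hj h0] at h'
  exact hij (congrArg Fin.val h')

/-- The graph of the action of `K` on coordinate `c` of component `n`. -/
def actGraph {N : Set ℕ} (K : Subgroup (WreathZ A5 N)) (n : N) (c : Fin (n : ℕ)) :
    Subgroup (K × A5) where
  carrier := {p | Acts n c p.1.1 p.2 ∧ Acts n c (p.1.1)⁻¹ p.2⁻¹}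
  one_mem' := ⟨Acts.one, by simpa using Acts.one⟩
  mul_mem' := by
    rintro p q ⟨h1, h2⟩ ⟨h3, h4⟩
    exact ⟨h1.mul h3, by simpa using h4.mul h2⟩
  inv_mem' := by
    rintro p ⟨h1, h2⟩
    exact ⟨h2, by simpa using h1⟩

theorem A5_not_solvable : ¬ Group.IsSolvable A5 := by
  intro h
  have hc := IsSimpleGroup.comm_iff_isSolvable.2 h
  have h1 := hc (⟨Equiv.swap 0 1 * Equiv.swap 1 2, Equiv.Perm.mem_alternatingGroup.2 (by decide)⟩ : A5)
    ⟨Equiv.swap 0 1 * Equiv.swap 1 3, Equiv.Perm.mem_alternatingGroup.2 (by decide)⟩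
  have h2 := congrArg (fun x : A5 => x.1 0) h1
  revert h2
  decide

theorem stmt4 (N : Set ℕ) (hpos : ∀ n ∈ N, 0 < n) (hinf : N.Infinite) :
    ¬∃ K : Subgroup (WreathZ A5 N), K.FiniteIndex ∧ IsSolvable K := by
  rintro ⟨K, hK, hsol⟩
  classical
  have hsol' : Group.IsSolvable K := hsol
  have : Fintype (WreathZ A5 N ⧸ K) := Fintype.ofFinite _
  obtain ⟨n, hn, hlt⟩ := hinf.exists_gt (Fintype.card (A5 → WreathZ A5 N ⧸ K))
  obtain ⟨i, j, hij, heq⟩ := Fintype.exists_ne_map_eq_of_card_lt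
    (fun (i : Fin n) (a : A5) => ((hconj i.1 a : WreathZ A5 N) : WreathZ A5 N ⧸ K))
    (by simpa only [Fintype.card_fin] using hlt)
  have hij' : i.1 ≠ j.1 := fun h => hij (Fin.ext h)
  let L := actGraph K ⟨n, hn⟩ i
  have hL : Group.IsSolvable L := by
    refine Group.isSolvable_of_isSolvable_injective (f := (MonoidHom.fst K A5).comp L.subtype) ?_
    rw [injective_iff_map_eq_one]
    rintro ⟨⟨x, a⟩, hx, hx2⟩ h
    obtain rfl : x = 1 := h
    obtain ⟨g', h1, h2⟩ := hx (fun _ => 1)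
    have h3 : (fun _ => 1) = g' := eq_of_heq (Sigma.mk.inj h1).2
    subst h3
    have : a = 1 := by simpa using h2.symm
    subst this
    rfl
  refine A5_not_solvable
    (Group.isSolvable_of_surjective (f := (MonoidHom.snd K A5).comp L.subtype) ?_)
  intro a
  have hmem : (hconj j.1 a)⁻¹ * hconj i.1 a ∈ K := QuotientGroup.eq.1 (congrFun heq a).symm
  refine ⟨⟨⟨⟨_, hmem⟩, a⟩, ?_, ?_⟩, rfl⟩
  · have := (acts_ne ⟨n, hn⟩ i.1 j.1 i.2 j.2 hij' a⁻¹).mul (acts_self ⟨n, hn⟩ i.1 i.2 a)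
    rw [one_mul, ← hconj_inv] at this
    exact this
  · have := (acts_self ⟨n, hn⟩ i.1 i.2 a⁻¹).mul (acts_ne ⟨n, hn⟩ i.1 j.1 i.2 j.2 hij' a)
    rw [mul_one, ← hconj_inv] at this
    simpa using this
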